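/- Fix an integer p ≥ 0, let m_{2p}(N) = ∫_ℝ x^{2p}·ρ_N(x) dx be the even GSE moments, C_p = (2p)!/(p!·(p+1)!) the Catalan number, and write γ_p = Γ(p+1/2)/(sqrt(π)·Γ(p+1)). Then, as N → ∞ through the integers, m_{2p}(N)/N^{p+1} = C_p + 4^{p−1}·(−1 + γ_p)·N^{−1} + (1/3)·4^{p−2}·p·(−3 + (7p−1)·γ_p)·N^{−2} + (1/3)·2^{2p−7}·p·(p−1)·(−8p + 7 + 2·(7p−2)·γ_p)·N^{−3} + (1/45)·2^{2p−9}·p·(p−1)·(p−2)·(−15·(8p−9) + (185p²−317p+6)·γ_p)·N^{−4} + (1/45)·2^{2p−13}·p·(p−1)·(p−2)·(p−3)·(−320p² + 1008p − 487 + 4·(185p²−387p+28)·γ_p)·N^{−5} + (1/2835)·2^{2p−15}·p·(p−1)·(p−2)·(p−3)·(p−4)·(−63·(320p²−1168p+675) + 4·(6209p³−29106p²+26605p−60)·γ_p)·N^{−6} + O(N^{−7}). -/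

import Mathlib

open Nat MeasureTheory

/-- The physicists' Hermite polynomials, via the recurrence
`H_0 = 1`, `H_1 = 2x`, `H_{n+2}(x) = 2x·H_{n+1}(x) − 2(n+1)·H_n(x)`. -/
def Hphys : ℕ → ℝ → ℝ
  | 0 => fun _ => 1
  | 1 => fun x => 2 * x
  | n + 2 => fun x => 2 * x * Hphys (n + 1) x - 2 * ((n : ℝ) + 1) * Hphys n x

/-- `Q_n(x) = ∫_{−∞}^{x} e^{−t²/2} H_n(t) dt`. -/
noncomputable def Qfun (n : ℕ) (x : ℝ) : ℝ :=
  ∫ t in Set.Iic x, Real.exp (-t ^ 2 / 2) * Hphys n t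

/-- `B_N = √π·2^{2N+1}·(2N−1)!`. -/
noncomputable def Bconst (N : ℕ) : ℝ :=
  Real.sqrt Real.pi * 2 ^ (2 * N + 1) * ((2 * N - 1)! : ℝ)

/-- The (unscaled) GSE eigenvalue density
`ρ_N(x) = B_N⁻¹(e^{−x²}(H_{2N}'H_{2N−1} − H_{2N}H_{2N−1}') + e^{−x²/2}H_{2N}Q_{2N−1})`. -/
noncomputable def gseDensity (N : ℕ) (x : ℝ) : ℝ :=
  (Bconst N)⁻¹ *
    (Real.exp (-x ^ 2) *
        (deriv (Hphys (2 * N)) x * Hphys (2 * N - 1) x -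
          Hphys (2 * N) x * deriv (Hphys (2 * N - 1)) x) +
      Real.exp (-x ^ 2 / 2) * Hphys (2 * N) x * Qfun (2 * N - 1) x)

/-- The even moments `m_{2p} = ∫_ℝ x^{2p} ρ_N(x) dx` of the unscaled GSE
eigenvalue density. -/
noncomputable def gseMoment (N p : ℕ) : ℝ :=
  ∫ x : ℝ, x ^ (2 * p) * gseDensity N x

/-- `γ_p = Γ(p+1/2)/(√π·Γ(p+1))`. -/
noncomputable def gammaRatio (p : ℕ) : ℝ :=
  Real.Gamma ((p : ℝ) + 1 / 2) / (Real.sqrt Real.pi * Real.Gamma ((p : ℝ) + 1))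


open Asymptotics Filter

/-- The moments `∫ x^{2p} H_n(x)² e^{-x²} dx`, divided by their leading large-`n` behaviour and
expressed through `s = 1/(2n)`. -/
noncomputable def sqMomentRatio : ℕ → ℝ → ℝ
  | 0 => fun _ => 1
  | 1 => fun s => 1 + s
  | p + 2 => fun s =>
      (1 + s) * sqMomentRatio (p + 1) s + ((p : ℝ) + 1) ^ 2 * s ^ 2 * sqMomentRatio p s

/-- The moments of `e^{-x²/2} H_{2N}(x) Q_{2N-1}(x)`, rescaled and expressed through
`s = 1/(4N)`. -/
noncomputable def crossMomentRatio : ℕ → ℝ → ℝ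
  | 0 => fun _ => 0
  | 1 => fun _ => -1 / 2
  | p + 2 => fun s =>
      (1 + s) * crossMomentRatio (p + 1) s +
        2 * ((p : ℝ) + 1) * (2 * p + 1) * s ^ 2 * crossMomentRatio p s +
        gammaRatio (p + 1) *
          ((3 * (1 + s) + (3 * ((p : ℝ) + 1) + 1 / 2) * s) * sqMomentRatio (p + 1) s -
            (2 + (2 * (p : ℝ) + 5) / (2 * p + 4)) * sqMomentRatio (p + 2) s)

lemma gammaRatio_zero : gammaRatio 0 = 1 := by
  have h : √Real.pi ≠ 0 := (Real.sqrt_pos.2 Real.pi_pos).ne'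
  rw [gammaRatio, Nat.cast_zero, zero_add, zero_add, Real.Gamma_one_half_eq, Real.Gamma_one,
    mul_one, div_self h]

lemma gammaRatio_succ (p : ℕ) :
    gammaRatio (p + 1) = gammaRatio p * ((2 * p + 1) / (2 * p + 2)) := by
  have h : √Real.pi ≠ 0 := (Real.sqrt_pos.2 Real.pi_pos).ne'
  have h1 : (p : ℝ) + 1 / 2 ≠ 0 := by positivity
  have h2 : (p : ℝ) + 1 ≠ 0 := by positivity
  have h3 : Real.Gamma ((p : ℝ) + 1) ≠ 0 := (Real.Gamma_pos_of_pos (by positivity)).ne'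
  have e : ((p + 1 : ℕ) : ℝ) + 1 / 2 = ((p : ℝ) + 1 / 2) + 1 := by push_cast; ring
  rw [gammaRatio, gammaRatio, e, Real.Gamma_add_one h1, Nat.cast_succ, Real.Gamma_add_one h2]
  field_simp

lemma catalan_eq_gammaRatio (p : ℕ) :
    ((2 * p)! : ℝ) / ((p ! : ℝ) * ((p + 1)! : ℝ)) = 4 ^ p * gammaRatio p / (p + 1) := by
  induction p with
  | zero => simp [gammaRatio_zero]
  | succ p ih =>
    have hp : ((p)! : ℝ) ≠ 0 := by positivity
    have h1 : (p : ℝ) + 1 ≠ 0 := by positivity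
    have h2 : (p : ℝ) + 2 ≠ 0 := by positivity
    have e : gammaRatio p = ((2 * p)! : ℝ) / ((p ! : ℝ) * ((p + 1)! : ℝ)) * (p + 1) / 4 ^ p := by
      rw [ih]; field_simp
    rw [gammaRatio_succ, e, show 2 * (p + 1) = 2 * p + 1 + 1 by ring]
    simp only [Nat.factorial_succ]
    push_cast
    field_simp
    ring

/-- The coefficient of `s^j` in `sqMomentRatio p s`, for `j ≤ 6`. -/
noncomputable def sqCoeff : ℕ → ℝ → ℝ
  | 0, _ => 1
  | 1, p => p
  | 2, p => (-p + p ^ 3) / 3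
  | 3, p => (2 * p ^ 2 - 3 * p ^ 3 + p ^ 4) / 3
  | 4, p => (12 * p - 40 * p ^ 2 + 15 * p ^ 3 + 35 * p ^ 4 - 27 * p ^ 5 + 5 * p ^ 6) / 90
  | 5, p => (-168 * p ^ 2 + 470 * p ^ 3 - 495 * p ^ 4 + 245 * p ^ 5 - 57 * p ^ 6 +
      5 * p ^ 7) / 90
  | 6, p => (-1440 * p + 11088 * p ^ 2 - 15470 * p ^ 3 - 63 * p ^ 4 + 13335 * p ^ 5 -
      10458 * p ^ 6 + 3540 * p ^ 7 - 567 * p ^ 8 + 35 * p ^ 9) / 5670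
  | _ + 7, _ => 0

/-- Minus the part of the coefficient of `s^j` in `crossMomentRatio p s` that is polynomial
in `p`, for `j ≤ 5`. -/
noncomputable def crossCoeffPoly : ℕ → ℝ → ℝ
  | 0, _ => 1
  | 1, p => p
  | 2, p => (7 * p - 15 * p ^ 2 + 8 * p ^ 3) / 6
  | 3, p => (-18 * p + 43 * p ^ 2 - 33 * p ^ 3 + 8 * p ^ 4) / 6
  | 4, p => (-2922 * p + 11405 * p ^ 2 - 15930 * p ^ 3 + 10055 * p ^ 4 - 2928 * p ^ 5 +
      320 * p ^ 6) / 360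
  | 5, p => (16200 * p - 61782 * p ^ 2 + 89705 * p ^ 3 - 63630 * p ^ 4 + 23555 * p ^ 5 -
      4368 * p ^ 6 + 320 * p ^ 7) / 360
  | _ + 6, _ => 0

/-- The factor of `gammaRatio p` in the coefficient of `s^j` in `crossMomentRatio p s`,
for `j ≤ 5`. -/
noncomputable def crossCoeffGamma : ℕ → ℝ → ℝ
  | 0, p => sqCoeff 0 p
  | 1, p => sqCoeff 1 p + (-p + 2 * p ^ 2)
  | 2, p => sqCoeff 2 p + (p - 3 * p ^ 2 + 2 * p ^ 3)
  | 3, p => sqCoeff 3 p + (-22 * p ^ 2 + 45 * p ^ 3 - 29 * p ^ 4 + 6 * p ^ 5) / 3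
  | 4, p => sqCoeff 4 p +
      (-6 * p + 89 * p ^ 2 - 185 * p ^ 3 + 145 * p ^ 4 - 49 * p ^ 5 + 6 * p ^ 6) / 3
  | 5, p => sqCoeff 5 p +
      (10152 * p ^ 2 - 32262 * p ^ 3 + 40307 * p ^ 4 - 25335 * p ^ 5 + 8483 * p ^ 6 -
        1443 * p ^ 7 + 98 * p ^ 8) / 90
  | _ + 6, _ => 0

lemma sqMomentRatio_add_two (p : ℕ) (s : ℝ) : sqMomentRatio (p + 2) s =
    (1 + s) * sqMomentRatio (p + 1) s + ((p : ℝ) + 1) ^ 2 * s ^ 2 * sqMomentRatio p s := rfl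

lemma crossMomentRatio_add_two (p : ℕ) (s : ℝ) : crossMomentRatio (p + 2) s =
    (1 + s) * crossMomentRatio (p + 1) s +
      2 * ((p : ℝ) + 1) * (2 * p + 1) * s ^ 2 * crossMomentRatio p s +
      gammaRatio (p + 1) *
        ((3 * (1 + s) + (3 * ((p : ℝ) + 1) + 1 / 2) * s) * sqMomentRatio (p + 1) s -
          (2 + (2 * (p : ℝ) + 5) / (2 * p + 4)) * sqMomentRatio (p + 2) s) := rfl

lemma sqMomentRatio_expansion (p : ℕ) :
    ∃ R : ℝ → ℝ, Continuous R ∧ ∀ s, sqMomentRatio p s =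
      ∑ j ∈ Finset.range 7, sqCoeff j p * s ^ j + s ^ 7 * R s := by
  induction p using Nat.twoStepInduction with
  | zero => exact ⟨0, continuous_const, fun s => by
      simp [sqMomentRatio, sqCoeff, Finset.sum_range_succ]⟩
  | one => exact ⟨0, continuous_const, fun s => by
      norm_num [sqMomentRatio, sqCoeff, Finset.sum_range_succ]⟩
  | more p ih₀ ih₁ =>
    obtain ⟨R₀, c₀, h₀⟩ := ih₀
    obtain ⟨R₁, c₁, h₁⟩ := ih₁
    refine ⟨fun s => (1 + s) * R₁ s + ((p : ℝ) + 1) ^ 2 * s ^ 2 * R₀ s + sqCoeff 6 (p + 1) +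
      ((p : ℝ) + 1) ^ 2 * (sqCoeff 5 p + s * sqCoeff 6 p), by fun_prop, fun s => ?_⟩
    rw [sqMomentRatio_add_two, h₀, h₁]
    simp only [sqCoeff, Finset.sum_range_succ, Finset.sum_range_zero]
    push_cast
    ring

lemma crossMomentRatio_expansion (p : ℕ) :
    ∃ R : ℝ → ℝ, Continuous R ∧ ∀ s, crossMomentRatio p s =
      ∑ j ∈ Finset.range 6, (gammaRatio p * crossCoeffGamma j p - crossCoeffPoly j p) * s ^ j +
        s ^ 6 * R s := by
  induction p using Nat.twoStepInduction with
  | zero => exact ⟨0, continuous_const, fun s => by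
      simp [crossMomentRatio, gammaRatio_zero, crossCoeffGamma, crossCoeffPoly, sqCoeff,
        Finset.sum_range_succ]⟩
  | one => exact ⟨0, continuous_const, fun s => by
      norm_num [crossMomentRatio, gammaRatio_zero, gammaRatio_succ 0, crossCoeffGamma,
        crossCoeffPoly, sqCoeff, Finset.sum_range_succ]⟩
  | more p ih₀ ih₁ =>
    obtain ⟨R₀, c₀, h₀⟩ := ih₀
    obtain ⟨R₁, c₁, h₁⟩ := ih₁
    obtain ⟨S₁, d₁, k₁⟩ := sqMomentRatio_expansion (p + 1)
    obtain ⟨S₂, d₂, k₂⟩ := sqMomentRatio_expansion (p + 2)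
    have hp1 : (p : ℝ) + 1 ≠ 0 := by positivity
    have hp2 : (p : ℝ) + 2 ≠ 0 := by positivity
    obtain ⟨e, he⟩ : ∃ e : ℝ, gammaRatio p = 4 * (p + 1) * (p + 2) * e :=
      ⟨gammaRatio p / (4 * (p + 1) * (p + 2)), by field_simp⟩
    have he1 : gammaRatio (p + 1) = 2 * (2 * p + 1) * (p + 2) * e := by
      rw [gammaRatio_succ, he]; field_simp; ring
    have he2 : gammaRatio (p + 2) = (2 * p + 1) * (2 * p + 3) * e := by
      rw [gammaRatio_succ, he1]; push_cast; field_simp; ring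
    have hq : gammaRatio (p + 1) * (2 + (2 * (p : ℝ) + 5) / (2 * p + 4)) =
        (2 * p + 1) * (6 * p + 13) * e := by
      rw [he1]; field_simp; ring
    refine ⟨fun s => (1 + s) * R₁ s + 2 * ((p : ℝ) + 1) * (2 * p + 1) * s ^ 2 * R₀ s +
      gammaRatio (p + 1) * ((3 * (1 + s) + (3 * ((p : ℝ) + 1) + 1 / 2) * s) *
        (sqCoeff 6 (p + 1) + s * S₁ s) -
          (2 + (2 * (p : ℝ) + 5) / (2 * p + 4)) * (sqCoeff 6 (p + 2) + s * S₂ s)) +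
      gammaRatio (p + 1) * (3 * ((p : ℝ) + 1) + 7 / 2) * sqCoeff 5 (p + 1) +
      (gammaRatio (p + 1) * crossCoeffGamma 5 (p + 1) - crossCoeffPoly 5 (p + 1)) +
      2 * ((p : ℝ) + 1) * (2 * p + 1) *
        ((gammaRatio p * crossCoeffGamma 4 p - crossCoeffPoly 4 p) +
          s * (gammaRatio p * crossCoeffGamma 5 p - crossCoeffPoly 5 p)), by fun_prop,
      fun s => ?_⟩
    rw [crossMomentRatio_add_two, h₀, h₁, k₁, k₂]
    simp only [mul_sub, ← mul_assoc, hq]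
    rw [he, he1, he2]
    simp only [sqCoeff, crossCoeffGamma, crossCoeffPoly, Finset.sum_range_succ,
      Finset.sum_range_zero]
    push_cast
    ring

/-- `gseMoment N p / (4^p N^{p+1})` expressed through `s = 1/(4N)`. -/
noncomputable def gseMomentRatio (p : ℕ) (s : ℝ) : ℝ :=
  gammaRatio p / (p + 1) * sqMomentRatio (p + 1) s - s * gammaRatio p * sqMomentRatio p s +
    s * crossMomentRatio p s

lemma gseMomentRatio_expansion (p : ℕ) :
    ∃ R : ℝ → ℝ, Continuous R ∧ ∀ s, gseMomentRatio p s =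
      gammaRatio p / (p + 1) + (-1 + gammaRatio p) * s +
      1 / 3 * p * (-3 + (7 * p - 1) * gammaRatio p) * s ^ 2 +
      1 / 6 * p * (p - 1) * (-8 * p + 7 + 2 * (7 * p - 2) * gammaRatio p) * s ^ 3 +
      1 / 90 * p * (p - 1) * (p - 2) *
        (-15 * (8 * p - 9) + (185 * p ^ 2 - 317 * p + 6) * gammaRatio p) * s ^ 4 +
      1 / 360 * p * (p - 1) * (p - 2) * (p - 3) *
        (-320 * p ^ 2 + 1008 * p - 487 +
          4 * (185 * p ^ 2 - 387 * p + 28) * gammaRatio p) * s ^ 5 +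
      1 / 22680 * p * (p - 1) * (p - 2) * (p - 3) * (p - 4) *
        (-63 * (320 * p ^ 2 - 1168 * p + 675) +
          4 * (6209 * p ^ 3 - 29106 * p ^ 2 + 26605 * p - 60) * gammaRatio p) * s ^ 6 +
      s ^ 7 * R s := by
  obtain ⟨R₀, c₀, h₀⟩ := sqMomentRatio_expansion p
  obtain ⟨R₁, c₁, h₁⟩ := sqMomentRatio_expansion (p + 1)
  obtain ⟨R₂, c₂, h₂⟩ := crossMomentRatio_expansion p
  refine ⟨fun s => gammaRatio p / (p + 1) * R₁ s - gammaRatio p * (sqCoeff 6 p + s * R₀ s) +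
    R₂ s, by fun_prop, fun s => ?_⟩
  have hp1 : (p : ℝ) + 1 ≠ 0 := by positivity
  obtain ⟨e, he⟩ : ∃ e : ℝ, gammaRatio p = (p + 1) * e := ⟨gammaRatio p / (p + 1), by field_simp⟩
  have he' : gammaRatio p / (p + 1) = e := by rw [he]; field_simp
  rw [gseMomentRatio, h₀, h₁, h₂, he', he]
  simp only [sqCoeff, crossCoeffGamma, crossCoeffPoly, Finset.sum_range_succ,
    Finset.sum_range_zero]
  push_cast
  ring

open Polynomial in
/-- The physicists' Hermite polynomials as elements of `ℝ[X]`. -/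
noncomputable def hermitePhys : ℕ → ℝ[X]
  | 0 => 1
  | 1 => 2 * X
  | n + 2 => 2 * X * hermitePhys (n + 1) - C (2 * ((n : ℝ) + 1)) * hermitePhys n

namespace Polynomial

lemma hermitePhys_add_two (n : ℕ) : hermitePhys (n + 2) =
    2 * X * hermitePhys (n + 1) - C (2 * ((n : ℝ) + 1)) * hermitePhys n := rfl

lemma Hphys_eq_eval_hermitePhys (n : ℕ) (x : ℝ) : Hphys n x = (hermitePhys n).eval x := by
  induction n using Nat.twoStepInduction with
  | zero => simp [Hphys, hermitePhys]
  | one => simp [Hphys, hermitePhys]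
  | more n h₀ h₁ =>
    rw [hermitePhys_add_two]
    simp [Hphys, h₀, h₁]

lemma derivative_hermitePhys_succ (n : ℕ) :
    derivative (hermitePhys (n + 1)) = C (2 * ((n : ℝ) + 1)) * hermitePhys n := by
  induction n using Nat.twoStepInduction with
  | zero => simp [hermitePhys, map_ofNat C 2]
  | one =>
    rw [hermitePhys_add_two]
    simp [hermitePhys, map_ofNat C 2]
    ring
  | more n h₀ h₁ =>
    rw [hermitePhys_add_two (n + 1), derivative_sub, derivative_mul, derivative_C_mul, h₁, h₀]
    simp only [derivative_mul, derivative_X, derivative_ofNat, map_mul, map_add, map_natCast,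
      map_one, map_ofNat]
    rw [hermitePhys_add_two n]
    simp only [map_mul, map_add, map_natCast, map_one, map_ofNat]
    push_cast
    ring

lemma hermitePhys_succ (n : ℕ) :
    hermitePhys (n + 1) = 2 * X * hermitePhys n - derivative (hermitePhys n) := by
  cases n with
  | zero => simp [hermitePhys]
  | succ n => rw [derivative_hermitePhys_succ, hermitePhys_add_two]

lemma natDegree_hermitePhys_le (n : ℕ) : (hermitePhys n).natDegree ≤ n := by
  induction n with
  | zero => simp [hermitePhys]
  | succ n ih =>
    rw [hermitePhys_succ]
    refine (natDegree_sub_le _ _).trans (max_le ?_ ?_)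
    · have h : (2 * X : ℝ[X]).natDegree ≤ 1 := by compute_degree
      exact natDegree_mul_le.trans (by omega)
    · exact (natDegree_derivative_le _).trans (by omega)

/-- The Hermite differential equation. -/
lemma derivative_derivative_hermitePhys (n : ℕ) :
    derivative (derivative (hermitePhys n)) =
      2 * X * derivative (hermitePhys n) - C (2 * (n : ℝ)) * hermitePhys n := by
  have h := congrArg derivative (hermitePhys_succ n)
  rw [derivative_hermitePhys_succ] at h
  simp only [derivative_sub, derivative_mul, derivative_X, derivative_ofNat, map_mul, map_add,
    map_natCast, map_one, map_ofNat] at h ⊢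
  linear_combination h

lemma integrable_eval_mul_exp (P : ℝ[X]) {b : ℝ} (hb : 0 < b) :
    Integrable fun x : ℝ => P.eval x * Real.exp (-b * x ^ 2) := by
  induction P using Polynomial.induction_on' with
  | add P Q hP hQ =>
    exact (hP.add hQ).congr <| .of_forall fun x => by
      simp only [Pi.add_apply, eval_add, add_mul]
  | monomial n a =>
    have h := (integrable_rpow_mul_exp_neg_mul_sq hb (s := n)
      (by linarith [n.cast_nonneg (α := ℝ)])).const_mul a
    simpa only [eval_monomial, Real.rpow_natCast, mul_assoc] using h

lemma integrable_eval_mul_exp_neg_sq (P : ℝ[X]) :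
    Integrable fun x : ℝ => P.eval x * Real.exp (-x ^ 2) := by
  simpa using P.integrable_eval_mul_exp one_pos

/-- Integration of polynomials against the weight `e^{-x²}`. -/
noncomputable def gaussIntegral : ℝ[X] →ₗ[ℝ] ℝ where
  toFun P := ∫ x : ℝ, P.eval x * Real.exp (-x ^ 2)
  map_add' P Q := by
    simp only [eval_add, add_mul]
    exact integral_add P.integrable_eval_mul_exp_neg_sq Q.integrable_eval_mul_exp_neg_sq
  map_smul' c P := by
    simp only [eval_smul, smul_eq_mul, mul_assoc, RingHom.id_apply]
    exact integral_const_mul c _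

lemma gaussIntegral_apply (P : ℝ[X]) :
    gaussIntegral P = ∫ x : ℝ, P.eval x * Real.exp (-x ^ 2) := rfl

lemma hasDerivAt_eval_mul_exp (P : ℝ[X]) (b x : ℝ) :
    HasDerivAt (fun x : ℝ => P.eval x * Real.exp (-b * x ^ 2))
      ((derivative P - C (2 * b) * X * P).eval x * Real.exp (-b * x ^ 2)) x := by
  have h := (P.hasDerivAt x).mul (((hasDerivAt_pow 2 x).const_mul (-b)).exp)
  refine h.congr_deriv ?_
  simp only [eval_sub, eval_mul, eval_C, eval_X, Nat.cast_ofNat]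
  ring

lemma gaussIntegral_derivative_sub (P : ℝ[X]) :
    gaussIntegral (derivative P - 2 * X * P) = 0 := by
  have h := integral_eq_zero_of_hasDerivAt_of_integrable (fun x => P.hasDerivAt_eval_mul_exp 1 x)
    (integrable_eval_mul_exp _ one_pos) (integrable_eval_mul_exp _ one_pos)
  simpa [gaussIntegral_apply] using h

lemma gaussIntegral_hermitePhys_succ_mul (n : ℕ) (P : ℝ[X]) :
    gaussIntegral (hermitePhys (n + 1) * P) = gaussIntegral (hermitePhys n * derivative P) := by
  have h := gaussIntegral_derivative_sub (hermitePhys n * P)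
  rw [← sub_eq_zero, ← map_sub, ← neg_eq_zero, ← map_neg, ← h, hermitePhys_succ, derivative_mul]
  congr 1
  ring

lemma gaussIntegral_hermitePhys_mul (n : ℕ) (P : ℝ[X]) :
    gaussIntegral (hermitePhys n * P) = gaussIntegral (derivative^[n] P) := by
  induction n generalizing P with
  | zero => simp [hermitePhys]
  | succ n ih => rw [gaussIntegral_hermitePhys_succ_mul, ih, Function.iterate_succ_apply]

lemma gaussIntegral_hermitePhys_sq (n : ℕ) :
    gaussIntegral (hermitePhys n * hermitePhys n) = √Real.pi * 2 ^ n * n ! := by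
  induction n with
  | zero =>
    have h := integral_gaussian 1
    simpa [hermitePhys, gaussIntegral_apply] using h
  | succ n ih =>
    rw [gaussIntegral_hermitePhys_succ_mul, derivative_hermitePhys_succ, mul_left_comm,
      ← smul_eq_C_mul, map_smul, ih, Nat.factorial_succ, smul_eq_mul]
    push_cast
    ring

/-- `e^{x²/2} Q_{2M+1}(x)` as a polynomial. -/
noncomputable def primitivePoly : ℕ → ℝ[X]
  | 0 => -2
  | M + 1 => C (4 * ((M : ℝ) + 1)) * primitivePoly M - 2 * hermitePhys (2 * M + 2)

lemma derivative_primitivePoly (M : ℕ) :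
    derivative (primitivePoly M) - X * primitivePoly M = hermitePhys (2 * M + 1) := by
  induction M with
  | zero => simp [primitivePoly, hermitePhys]; ring
  | succ M ih =>
    have h1 := derivative_hermitePhys_succ (2 * M + 1)
    have h2 := hermitePhys_add_two (2 * M + 1)
    rw [primitivePoly, show 2 * (M + 1) + 1 = 2 * M + 1 + 2 by ring, h2, ← ih]
    rw [← ih] at h1
    simp only [derivative_sub, derivative_mul, derivative_natCast, derivative_one,
      derivative_ofNat, map_mul, map_add, map_natCast, map_one, map_ofNat] at h1 ⊢
    push_cast at h1 ⊢
    linear_combination -2 * h1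

lemma natDegree_primitivePoly_lt (M : ℕ) : (primitivePoly M).natDegree < 2 * M + 2 := by
  induction M with
  | zero =>
    rw [primitivePoly, natDegree_neg]
    simp
  | succ M ih =>
    have h := natDegree_hermitePhys_le (2 * M + 2)
    rw [primitivePoly, ← C_ofNat]
    have h1 := natDegree_sub_le (C (4 * ((M : ℝ) + 1)) * primitivePoly M)
      (C 2 * hermitePhys (2 * M + 2))
    have h2 := natDegree_C_mul_le (4 * ((M : ℝ) + 1)) (primitivePoly M)
    have h3 := natDegree_C_mul_le (2 : ℝ) (hermitePhys (2 * M + 2))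
    omega

lemma Qfun_eq (M : ℕ) (x : ℝ) :
    Qfun (2 * M + 1) x = (primitivePoly M).eval x * Real.exp (-x ^ 2 / 2) := by
  have hd := fun x => (primitivePoly M).hasDerivAt_eval_mul_exp (1 / 2) x
  have hi : Integrable fun x : ℝ => (derivative (primitivePoly M) -
      C (2 * (1 / 2)) * X * primitivePoly M).eval x * Real.exp (-(1 / 2) * x ^ 2) :=
    integrable_eval_mul_exp _ one_half_pos
  have hi' := (primitivePoly M).integrable_eval_mul_exp one_half_pos
  have ht : Filter.Tendsto (fun x : ℝ => (primitivePoly M).eval x * Real.exp (-(1 / 2) * x ^ 2))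
      Filter.atBot (nhds 0) :=
    tendsto_zero_of_hasDerivAt_of_integrableOn_Iic (a := 0) (fun x _ => hd x)
      hi.integrableOn hi'.integrableOn
  have h := integral_Iic_of_hasDerivAt_of_tendsto' (a := x) (fun x _ => hd x) hi.integrableOn ht
  have e : ∀ t : ℝ, -(1 / 2) * t ^ 2 = -t ^ 2 / 2 := fun t => by ring
  have e2 : derivative (primitivePoly M) - C (2 * (1 / 2)) * X * primitivePoly M =
      hermitePhys (2 * M + 1) := by
    rw [← derivative_primitivePoly]; norm_num
  simp only [e, e2, sub_zero] at h
  rw [← h, Qfun]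
  simp only [Hphys_eq_eval_hermitePhys, mul_comm]

lemma gaussIntegral_X_pow_mul (k : ℕ) (P : ℝ[X]) :
    k * gaussIntegral (X ^ (k - 1) * P) +
      gaussIntegral (X ^ k * (derivative P - 2 * X * P)) = 0 := by
  rw [← gaussIntegral_derivative_sub (X ^ k * P), ← smul_eq_mul, ← map_smul, ← map_add,
    smul_eq_C_mul, derivative_mul, derivative_X_pow]
  congr 1
  ring

section MomentRecurrences

variable {h r : ℝ[X]} {c : ℝ}

lemma gaussIntegral_X_pow_mul_sq (h : ℝ[X]) (k : ℕ) :
    k * gaussIntegral (X ^ (k - 1) * (h * h)) +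
      2 * gaussIntegral (X ^ k * (h * (derivative h - X * h))) = 0 := by
  rw [← gaussIntegral_X_pow_mul k (h * h), ← smul_eq_mul (2 : ℝ), ← map_smul, smul_eq_C_mul,
    derivative_mul, map_ofNat]
  congr 2
  ring

lemma gaussIntegral_X_pow_mul_mul_deriv
    (hh : derivative (derivative h) = 2 * X * derivative h - C c * h) (k : ℕ) :
    k * gaussIntegral (X ^ (k - 1) * (h * (derivative h - X * h))) +
      (gaussIntegral (X ^ k * ((derivative h - X * h) * (derivative h - X * h))) +
        gaussIntegral (X ^ (k + 2) * (h * h)) -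
        (c + 1) * gaussIntegral (X ^ k * (h * h))) = 0 := by
  rw [← gaussIntegral_X_pow_mul k (h * (derivative h - X * h)), ← smul_eq_mul (c + 1),
    ← map_smul, ← map_add, ← map_sub, smul_eq_C_mul]
  congr 2
  simp only [derivative_mul, derivative_sub, derivative_X, hh, map_add, map_one]
  ring

lemma gaussIntegral_X_pow_mul_deriv_sq
    (hh : derivative (derivative h) = 2 * X * derivative h - C c * h) (k : ℕ) :
    k * gaussIntegral (X ^ (k - 1) * ((derivative h - X * h) * (derivative h - X * h))) +
      (2 * gaussIntegral (X ^ (k + 2) * (h * (derivative h - X * h))) -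
        2 * (c + 1) * gaussIntegral (X ^ k * (h * (derivative h - X * h)))) = 0 := by
  rw [← gaussIntegral_X_pow_mul k ((derivative h - X * h) * (derivative h - X * h)),
    ← smul_eq_mul (2 * (c + 1)), ← smul_eq_mul (2 : ℝ), ← map_smul, ← map_smul, ← map_sub,
    smul_eq_C_mul, smul_eq_C_mul]
  congr 2
  simp only [derivative_mul, derivative_sub, derivative_X, hh, map_add, map_one, map_mul,
    map_ofNat]
  ring

lemma gaussIntegral_X_pow_mul_cross (hr : derivative r = X * r + derivative h) (k : ℕ) :
    k * gaussIntegral (X ^ (k - 1) * (h * r)) +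
      (gaussIntegral (X ^ k * ((derivative h - X * h) * r)) +
        gaussIntegral (X ^ k * (h * (derivative h - X * h))) +
        gaussIntegral (X ^ (k + 1) * (h * h))) = 0 := by
  rw [← gaussIntegral_X_pow_mul k (h * r), ← map_add, ← map_add]
  congr 2
  simp only [derivative_mul, hr]
  ring

lemma gaussIntegral_X_pow_mul_deriv_cross
    (hh : derivative (derivative h) = 2 * X * derivative h - C c * h)
    (hr : derivative r = X * r + derivative h) (k : ℕ) :
    k * gaussIntegral (X ^ (k - 1) * ((derivative h - X * h) * r)) +
      (gaussIntegral (X ^ (k + 2) * (h * r)) - (c + 1) * gaussIntegral (X ^ k * (h * r)) +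
        gaussIntegral (X ^ k * ((derivative h - X * h) * (derivative h - X * h))) +
        gaussIntegral (X ^ (k + 1) * (h * (derivative h - X * h)))) = 0 := by
  rw [← gaussIntegral_X_pow_mul k ((derivative h - X * h) * r), ← smul_eq_mul (c + 1),
    ← map_smul, ← map_sub, ← map_add, ← map_add, smul_eq_C_mul]
  congr 2
  simp only [derivative_mul, derivative_sub, derivative_X, hh, hr, map_add, map_one]
  ring

lemma deriv_sq_moment
    (hh : derivative (derivative h) = 2 * X * derivative h - C c * h) (k : ℕ) :
    (k + 1) * gaussIntegral (X ^ k * ((derivative h - X * h) * (derivative h - X * h))) =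
      (k + 3) * gaussIntegral (X ^ (k + 2) * (h * h)) -
        (c + 1) * (k + 1) * gaussIntegral (X ^ k * (h * h)) := by
  have h1 := gaussIntegral_X_pow_mul_sq h (k + 1)
  have h3 := gaussIntegral_X_pow_mul_sq h (k + 3)
  have h2 := gaussIntegral_X_pow_mul_deriv_sq hh (k + 1)
  simp only [Nat.add_sub_cancel, show k + 3 - 1 = k + 2 by omega, show k + 1 + 2 = k + 3 by ring]
    at h1 h2 h3
  push_cast at h1 h2 h3
  linear_combination h2 + (c + 1) * h1 - h3

lemma sq_moment_two (hh : derivative (derivative h) = 2 * X * derivative h - C c * h) :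
    2 * gaussIntegral (X ^ 2 * (h * h)) = (c + 1) * gaussIntegral (X ^ 0 * (h * h)) := by
  have h1 := gaussIntegral_X_pow_mul_mul_deriv hh 0
  have h2 := deriv_sq_moment hh 0
  push_cast at h1 h2
  linear_combination h1 / 2 - h2 / 2

lemma sq_moment_add_four
    (hh : derivative (derivative h) = 2 * X * derivative h - C c * h) (k : ℕ) :
    (2 * k + 8) * gaussIntegral (X ^ (k + 4) * (h * h)) =
      2 * (c + 1) * (k + 3) * gaussIntegral (X ^ (k + 2) * (h * h)) +
        (k + 1) * (k + 2) * (k + 3) / 2 * gaussIntegral (X ^ k * (h * h)) := by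
  have h1 := gaussIntegral_X_pow_mul_mul_deriv hh (k + 2)
  have h2 := deriv_sq_moment hh (k + 2)
  have h3 := gaussIntegral_X_pow_mul_sq h (k + 1)
  simp only [Nat.add_sub_cancel, show k + 2 - 1 = k + 1 by omega] at h1 h2 h3
  push_cast at h1 h2 h3
  linear_combination (k + 3) * h1 - h2 - (k + 2) * (k + 3) / 2 * h3

lemma cross_moment_two (hh : derivative (derivative h) = 2 * X * derivative h - C c * h)
    (hr : derivative r = X * r + derivative h) :
    gaussIntegral (X ^ 2 * (h * r)) = (c + 1) * gaussIntegral (X ^ 0 * (h * r)) -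
      c / 2 * gaussIntegral (X ^ 0 * (h * h)) := by
  have h1 := gaussIntegral_X_pow_mul_deriv_cross hh hr 0
  have h2 := deriv_sq_moment hh 0
  have h3 := gaussIntegral_X_pow_mul_sq h 1
  have h4 := sq_moment_two hh
  push_cast at h1 h2 h3
  simp only [zero_add] at h1 h2 h3
  linear_combination h1 - h2 - h3 / 2 - 3 / 2 * h4

lemma cross_moment_add_four (hh : derivative (derivative h) = 2 * X * derivative h - C c * h)
    (hr : derivative r = X * r + derivative h) (k : ℕ) :
    gaussIntegral (X ^ (k + 4) * (h * r)) =
      (c + 1) * gaussIntegral (X ^ (k + 2) * (h * r)) +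
        (k + 1) * (k + 2) * gaussIntegral (X ^ k * (h * r)) -
        (k + 1) * (k + 2) / 2 * gaussIntegral (X ^ k * (h * h)) +
        (c + 1 + k + 2 + (k + 3) / 2) * gaussIntegral (X ^ (k + 2) * (h * h)) -
        (k + 5) / (k + 3) * gaussIntegral (X ^ (k + 4) * (h * h)) := by
  have h1 := gaussIntegral_X_pow_mul_deriv_cross hh hr (k + 2)
  have h2 := deriv_sq_moment hh (k + 2)
  have h3 := gaussIntegral_X_pow_mul_sq h (k + 1)
  have h4 := gaussIntegral_X_pow_mul_sq h (k + 3)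
  have h5 := gaussIntegral_X_pow_mul_cross hr (k + 1)
  simp only [Nat.add_sub_cancel, show k + 2 - 1 = k + 1 by omega,
    show k + 3 - 1 = k + 2 by omega, show k + 1 + 1 = k + 2 by ring,
    show k + 2 + 1 = k + 3 by ring, show k + 2 + 2 = k + 4 by ring] at h1 h2 h3 h4 h5
  push_cast at h1 h2 h3 h4 h5
  have hk : (k : ℝ) + 3 ≠ 0 := by positivity
  have h2' : gaussIntegral (X ^ (k + 2) * ((derivative h - X * h) * (derivative h - X * h))) =
      (k + 5) / (k + 3) * gaussIntegral (X ^ (k + 4) * (h * h)) -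
        (c + 1) * gaussIntegral (X ^ (k + 2) * (h * h)) := by
    field_simp
    linear_combination h2
  linear_combination h1 - (k + 2) * h5 + (k + 2) / 2 * h3 - h4 / 2 - h2'

lemma sq_moment_eq (hh : derivative (derivative h) = 2 * X * derivative h - C c * h)
    (hc : c ≠ 0) (p : ℕ) :
    gaussIntegral (X ^ (2 * p) * (h * h)) =
      gaussIntegral (h * h) * (c ^ p * (gammaRatio p * sqMomentRatio p c⁻¹)) := by
  induction p using Nat.twoStepInduction with
  | zero => simp [gammaRatio_zero, sqMomentRatio]
  | one =>
    have h1 := sq_moment_two hh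
    simp only [pow_zero, one_mul] at h1
    rw [gammaRatio_succ, gammaRatio_zero, sqMomentRatio]
    push_cast
    field_simp
    linear_combination h1
  | more p h₀ h₁ =>
    have h1 := sq_moment_add_four hh (2 * p)
    rw [show 2 * p + 2 = 2 * (p + 1) by ring, h₀, h₁, gammaRatio_succ] at h1
    rw [show 2 * (p + 2) = 2 * p + 4 by ring, gammaRatio_succ, gammaRatio_succ,
      sqMomentRatio_add_two]
    refine mul_left_cancel₀ (show (2 * (2 * p : ℕ) + 8 : ℝ) ≠ 0 by positivity) (h1.trans ?_)
    push_cast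
    field_simp
    ring

lemma cross_moment_eq (hh : derivative (derivative h) = 2 * X * derivative h - C c * h)
    (hr : derivative r = X * r + derivative h) (h0 : gaussIntegral (h * r) = 0)
    (hc : c ≠ 0) (p : ℕ) :
    gaussIntegral (X ^ (2 * p) * (h * r)) =
      gaussIntegral (h * h) * (c ^ p * crossMomentRatio p c⁻¹) := by
  induction p using Nat.twoStepInduction with
  | zero => simp [h0, crossMomentRatio]
  | one =>
    have h1 := cross_moment_two hh hr
    simp only [pow_zero, one_mul, h0] at h1
    rw [mul_one, h1, crossMomentRatio]
    ring
  | more p h₀ h₁ =>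
    have h1 := cross_moment_add_four hh hr (2 * p)
    rw [show 2 * p + 4 = 2 * (p + 2) by ring, show 2 * p + 2 = 2 * (p + 1) by ring, h₀, h₁,
      sq_moment_eq hh hc, sq_moment_eq hh hc, sq_moment_eq hh hc] at h1
    have hX : ((p : ℝ) + 1) ^ 2 * sqMomentRatio p c⁻¹ =
        c ^ 2 * sqMomentRatio (p + 2) c⁻¹ - c * (c + 1) * sqMomentRatio (p + 1) c⁻¹ := by
      rw [sqMomentRatio_add_two]
      field_simp
      ring
    have hg : (2 * (p : ℝ) + 1) * gammaRatio p = 2 * (p + 1) * gammaRatio (p + 1) := by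
      rw [gammaRatio_succ]; field_simp
    have hg2 : (2 * (p : ℝ) + 5) / (2 * p + 3) * gammaRatio (p + 2) =
        (2 * p + 5) / (2 * p + 4) * gammaRatio (p + 1) := by
      rw [gammaRatio_succ]; push_cast; field_simp; ring
    rw [h1, crossMomentRatio_add_two]
    push_cast
    have hci : c * c⁻¹ = 1 := mul_inv_cancel₀ hc
    linear_combination gaussIntegral (h * h) * c ^ p *
      (-(p + 1) * sqMomentRatio p c⁻¹ * hg - 2 * gammaRatio (p + 1) * hX -
        c ^ 2 * sqMomentRatio (p + 2) c⁻¹ * hg2 -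
        (c * (crossMomentRatio (p + 1) c⁻¹ +
            gammaRatio (p + 1) * sqMomentRatio (p + 1) c⁻¹ * (3 * p + 13 / 2)) +
          2 * (p + 1) * (2 * p + 1) * crossMomentRatio p c⁻¹ * (1 + c * c⁻¹)) * hci)

end MomentRecurrences

end Polynomial

open Polynomial in
lemma gseMoment_eq (M p : ℕ) : gseMoment (M + 1) p =
    (4 * ((M : ℝ) + 1)) ^ (p + 1) / 4 * gseMomentRatio p (4 * ((M : ℝ) + 1))⁻¹ := by
  set c : ℝ := 4 * ((M : ℝ) + 1) with hc_def
  have hc : c ≠ 0 := by positivity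
  set h : ℝ[X] := hermitePhys (2 * M + 2) with h_def
  set r : ℝ[X] := C c * primitivePoly M with r_def
  have hd : derivative h = C c * hermitePhys (2 * M + 1) := by
    rw [h_def, derivative_hermitePhys_succ]
    congr 2
    push_cast
    ring
  have hh : derivative (derivative h) = 2 * X * derivative h - C c * h := by
    rw [h_def, derivative_derivative_hermitePhys]
    congr 3
    push_cast
    ring
  have hr : derivative r = X * r + derivative h := by
    rw [hd, ← derivative_primitivePoly, r_def, derivative_C_mul]
    ring
  have h0 : gaussIntegral (h * r) = 0 := by
    rw [h_def, gaussIntegral_hermitePhys_mul, iterate_derivative_eq_zero, map_zero]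
    exact (natDegree_C_mul_le _ _).trans_lt (natDegree_primitivePoly_lt M)
  have hB : c * Bconst (M + 1) = 4 * gaussIntegral (h * h) := by
    rw [h_def, gaussIntegral_hermitePhys_sq, Bconst, show 2 * (M + 1) - 1 = 2 * M + 1 by omega,
      Nat.factorial_succ (2 * M + 1)]
    push_cast
    ring
  have hA : gaussIntegral (h * h) ≠ 0 := by
    rw [h_def, gaussIntegral_hermitePhys_sq]
    positivity
  have hρ : ∀ x : ℝ, x ^ (2 * p) * gseDensity (M + 1) x = (c * Bconst (M + 1))⁻¹ *
      ((X ^ (2 * p) * ((derivative h - X * h) * (derivative h - X * h)) -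
        X ^ (2 * p + 2) * (h * h) + c • (X ^ (2 * p) * (h * h)) +
          X ^ (2 * p) * (h * r)).eval x * Real.exp (-x ^ 2)) := by
    intro x
    have e1 : Real.exp (-x ^ 2) = Real.exp (-x ^ 2 / 2) * Real.exp (-x ^ 2 / 2) := by
      rw [← Real.exp_add]; ring_nf
    have hd2 : derivative (derivative h) = C c * derivative (hermitePhys (2 * M + 1)) := by
      rw [hd, derivative_C_mul]
    have e2 := congrArg (eval x) hd
    have e3 := congrArg (eval x) (hd2.symm.trans hh)
    have dv : ∀ n, deriv (Hphys n) x = (derivative (hermitePhys n)).eval x := fun n => by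
      rw [funext (Hphys_eq_eval_hermitePhys n), Polynomial.deriv]
    rw [gseDensity, show 2 * (M + 1) - 1 = 2 * M + 1 by omega, show 2 * (M + 1) = 2 * M + 2 by ring,
      dv, dv, Hphys_eq_eval_hermitePhys, Hphys_eq_eval_hermitePhys, Qfun_eq, ← h_def, mul_inv, e1]
    simp only [r_def, eval_add, eval_sub, eval_mul, eval_pow, eval_X, eval_C, eval_smul,
      eval_ofNat, smul_eq_mul] at e2 e3 ⊢
    have hci : c⁻¹ * c = 1 := inv_mul_cancel₀ hc
    linear_combination x ^ (2 * p) * (Bconst (M + 1))⁻¹ * Real.exp (-x ^ 2 / 2) ^ 2 *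
      (-((derivative h).eval x * (hermitePhys (2 * M + 1)).eval x -
          h.eval x * (derivative (hermitePhys (2 * M + 1))).eval x +
          h.eval x * (primitivePoly M).eval x) * hci -
        c⁻¹ * (derivative h).eval x * e2 - c⁻¹ * h.eval x * e3)
  rw [gseMoment, integral_congr_ae (.of_forall hρ), integral_const_mul, ← gaussIntegral_apply,
    map_add, map_add, map_sub, map_smul, smul_eq_mul, hB]
  have hs := deriv_sq_moment hh (2 * p)
  rw [show 2 * p + 2 = 2 * (p + 1) by ring] at hs ⊢
  rw [sq_moment_eq hh hc, sq_moment_eq hh hc] at hs ⊢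
  rw [cross_moment_eq hh hr h0 hc, gseMomentRatio]
  clear_value c
  rw [gammaRatio_succ] at hs ⊢
  push_cast at hs
  field_simp at hs ⊢
  linear_combination c * hs

/-- Large-`N` asymptotic expansion of the even GSE moments up to and
including the term of order `N^{−6}`, with error `O(N^{−7})`. -/
theorem gseMoment_largeN (p : ℕ) :
    (fun N : ℕ =>
        gseMoment N p / (N : ℝ) ^ (p + 1) -
          (((2 * p)! : ℝ) / ((p ! : ℝ) * ((p + 1)! : ℝ)) +
            (4 : ℝ) ^ ((p : ℤ) - 1) * (-1 + gammaRatio p) * ((N : ℝ))⁻¹ +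
            (1 / 3) * (4 : ℝ) ^ ((p : ℤ) - 2) * (p : ℝ) *
              (-3 + (7 * (p : ℝ) - 1) * gammaRatio p) * ((N : ℝ) ^ 2)⁻¹ +
            (1 / 3) * (2 : ℝ) ^ (2 * (p : ℤ) - 7) * (p : ℝ) * ((p : ℝ) - 1) *
              (-8 * (p : ℝ) + 7 + 2 * (7 * (p : ℝ) - 2) * gammaRatio p) * ((N : ℝ) ^ 3)⁻¹ +
            (1 / 45) * (2 : ℝ) ^ (2 * (p : ℤ) - 9) * (p : ℝ) * ((p : ℝ) - 1) * ((p : ℝ) - 2) *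
              (-15 * (8 * (p : ℝ) - 9) +
                (185 * (p : ℝ) ^ 2 - 317 * (p : ℝ) + 6) * gammaRatio p) * ((N : ℝ) ^ 4)⁻¹ +
            (1 / 45) * (2 : ℝ) ^ (2 * (p : ℤ) - 13) * (p : ℝ) * ((p : ℝ) - 1) * ((p : ℝ) - 2) *
              ((p : ℝ) - 3) *
              (-320 * (p : ℝ) ^ 2 + 1008 * (p : ℝ) - 487 +
                4 * (185 * (p : ℝ) ^ 2 - 387 * (p : ℝ) + 28) * gammaRatio p) * ((N : ℝ) ^ 5)⁻¹ +
            (1 / 2835) * (2 : ℝ) ^ (2 * (p : ℤ) - 15) * (p : ℝ) * ((p : ℝ) - 1) * ((p : ℝ) - 2) *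
              ((p : ℝ) - 3) * ((p : ℝ) - 4) *
              (-63 * (320 * (p : ℝ) ^ 2 - 1168 * (p : ℝ) + 675) +
                4 * (6209 * (p : ℝ) ^ 3 - 29106 * (p : ℝ) ^ 2 + 26605 * (p : ℝ) - 60) *
                  gammaRatio p) * ((N : ℝ) ^ 6)⁻¹)) =O[atTop]
      fun N : ℕ => ((N : ℝ) ^ 7)⁻¹ := by
  obtain ⟨R, hR, hE⟩ := gseMomentRatio_expansion p
  have hlim : Tendsto (fun N : ℕ => (4 * (N : ℝ))⁻¹) atTop (nhds 0) :=
    (tendsto_natCast_atTop_atTop.const_mul_atTop four_pos).inv_tendsto_atTop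
  have hb : (fun N : ℕ => 4 ^ p / 4 ^ 7 * R (4 * (N : ℝ))⁻¹) =O[atTop] fun _ => (1 : ℝ) :=
    (((hR.tendsto 0).comp hlim).const_mul _).isBigO_one ℝ
  refine (hb.mul (isBigO_refl (fun N : ℕ => ((N : ℝ) ^ 7)⁻¹) atTop)).congr' ?_ (by simp)
  filter_upwards [eventually_gt_atTop 0] with N hN
  obtain ⟨M, rfl⟩ : ∃ M, N = M + 1 := ⟨N - 1, by omega⟩
  have hM : ((M + 1 : ℕ) : ℝ) ≠ 0 := by positivity
  have hz : ∀ k : ℕ, (2 : ℝ) ^ (2 * (p : ℤ) - k) = 4 ^ p / 2 ^ k := fun k => by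
    rw [zpow_sub₀ two_ne_zero, zpow_mul, zpow_natCast, zpow_natCast]
    norm_num
  have hz' : ∀ k : ℕ, (4 : ℝ) ^ ((p : ℤ) - k) = 4 ^ p / 4 ^ k := fun k => by
    rw [zpow_sub₀ four_ne_zero, zpow_natCast, zpow_natCast]
  have z1 := hz' 1
  have z2 := hz' 2
  have z3 := hz 7
  have z4 := hz 9
  have z5 := hz 13
  have z6 := hz 15
  push_cast at z1 z2 z3 z4 z5 z6
  rw [z1, z2, z3, z4, z5, z6, catalan_eq_gammaRatio, gseMoment_eq, ← Nat.cast_add_one, hE,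
    mul_pow (4 : ℝ), mul_inv]
  generalize gammaRatio p = g
  generalize R _ = ρ
  generalize ((M + 1 : ℕ) : ℝ) = n at *
  field_simp
  ring
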